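/- Let m, n, N ≥ 1, let f : [0,∞) → ℝ be monotonically increasing and convex, and define f₊ : ℝ → ℝ by f₊(x) = f(x) for x ≥ 0 and f₊(x) = f(0) for x ≤ 0. Let x₀, y₀ ∈ ℝ^N and x_{ij}, y_{ij} ∈ ℝ^N for 1 ≤ i ≤ m, 1 ≤ j ≤ n satisfy: ‖x_{ij} − x_{kℓ}‖ ≤ ‖y_{ij} − y_{kℓ}‖ for all i ≠ k and all j, ℓ; ‖x_{ij} − x_{iℓ}‖ ≥ ‖y_{ij} − y_{iℓ}‖ for all i, j, ℓ; and ‖x_{ij} − x₀‖ ≥ ‖y_{ij} − y₀‖ for all i, j. Then for a standard Gaussian vector g in ℝ^N, assuming both expectations exist, E[ min_{1≤i≤m} max_{1≤j≤n} f₊(⟨x_{ij} − x₀, g⟩) ] ≥ E[ min_{1≤i≤m} max_{1≤j≤n} f₊(⟨y_{ij} − y₀, g⟩) ]. -/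

import Mathlib

open MeasureTheory ProbabilityTheory Metric Set
open scoped InnerProductSpace
open scoped Classical
open scoped Pointwise

noncomputable section

/-- Euclidean space `ℝ^k`. -/
abbrev Euc (k : ℕ) : Type := EuclideanSpace ℝ (Fin k)

/-- The linear action of a matrix `A ∈ ℝ^{n×m}` on Euclidean space, `x ↦ Ax`. -/
def mulE {m n : ℕ} (A : Matrix (Fin n) (Fin m) ℝ) (x : Euc m) : Euc n :=
  Matrix.toEuclideanLin A x

/-- The metric projection onto a set `S`: the point of `S` closest to `y`
(if a unique closest point characterizing property holds; junk value `0` otherwise). -/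
def metricProj {k : ℕ} (S : Set (Euc k)) (y : Euc k) : Euc k :=
  if h : ∃ z, z ∈ S ∧ ∀ w ∈ S, dist y z ≤ dist y w then h.choose else 0

/-- `C` is a closed convex cone (containing the origin). -/
def IsClosedConvexCone {k : ℕ} (C : Set (Euc k)) : Prop :=
  IsClosed C ∧ Convex ℝ C ∧ (∀ c : ℝ, 0 ≤ c → ∀ x ∈ C, c • x ∈ C) ∧ (0 : Euc k) ∈ C

/-- The polar cone `S° = {z | ⟨x,z⟩ ≤ 0 ∀ x ∈ S}`. -/
def polarCone {k : ℕ} (S : Set (Euc k)) : Set (Euc k) :=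
  {z | ∀ x ∈ S, ⟪x, z⟫_ℝ ≤ 0}

/-- The restricted norm `‖A‖_{C→D} = max_{x ∈ C ∩ S^{m-1}} ‖Proj_D (Ax)‖`. -/
def resNorm {m n : ℕ} (C : Set (Euc m)) (D : Set (Euc n)) (A : Matrix (Fin n) (Fin m) ℝ) : ℝ :=
  sSup ((fun x => ‖metricProj D (mulE A x)‖) '' (C ∩ sphere 0 1))

/-- The restricted singular value `σ_{C→D}(A) = min_{x ∈ C ∩ S^{m-1}} ‖Proj_D (Ax)‖`. -/
def resSval {m n : ℕ} (C : Set (Euc m)) (D : Set (Euc n)) (A : Matrix (Fin n) (Fin m) ℝ) : ℝ :=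
  sInf ((fun x => ‖metricProj D (mulE A x)‖) '' (C ∩ sphere 0 1))

/-- The restricted norm for arbitrary (not necessarily closed) cones:
`‖B‖_{K→K'} = sup { ⟨Bx, y⟩ : x ∈ K ∩ B^ℓ, y ∈ K' ∩ B^p }`. -/
def resNormGen {l p : ℕ} (K : Set (Euc l)) (K' : Set (Euc p))
    (B : Matrix (Fin p) (Fin l) ℝ) : ℝ :=
  sSup (Set.image2 (fun x y => ⟪mulE B x, y⟫_ℝ) (K ∩ closedBall 0 1) (K' ∩ closedBall 0 1))

/-- The operator (spectral) norm of a matrix. -/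
def opNorm {m n : ℕ} (A : Matrix (Fin n) (Fin m) ℝ) : ℝ :=
  ‖LinearMap.toContinuousLinearMap (Matrix.toEuclideanLin A)‖

/-- The standard Gaussian measure on `ℝ^k` (i.i.d. N(0,1) coordinates). -/
def stdGaussianE (k : ℕ) : Measure (Euc k) :=
  Measure.map (⇑(EuclideanSpace.equiv (Fin k) ℝ).symm)
    (Measure.pi fun _ : Fin k => gaussianReal 0 1)

/-- The standard Gaussian measure on `n × m` arrays (i.i.d. N(0,1) entries). -/
def stdGaussianPi (n m : ℕ) : Measure (Fin n → Fin m → ℝ) :=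
  Measure.pi fun _ : Fin n => Measure.pi fun _ : Fin m => gaussianReal 0 1

/-- The support function `h_K(x) = sup_{z ∈ K} ⟨x, z⟩`. -/
def suppFn {k : ℕ} (K : Set (Euc k)) (x : Euc k) : ℝ := sSup ((fun z => ⟪x, z⟫_ℝ) '' K)

/-- The capped-angle cosine `cos d̄(X,Y) = max{⟨x,y⟩ : x ∈ X ∩ B, y ∈ Y ∩ B}`. -/
def cosAng {k : ℕ} (X Y : Set (Euc k)) : ℝ :=
  sSup (Set.image2 (fun x y => ⟪x, y⟫_ℝ) (X ∩ closedBall 0 1) (Y ∩ closedBall 0 1))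

/-- `sin d̄(X,Y) = √(1 - cos d̄(X,Y)²)`. -/
def sinAng {k : ℕ} (X Y : Set (Euc k)) : ℝ := Real.sqrt (1 - cosAng X Y ^ 2)

/-- The Kronecker (tensor) product `x ⊗ y ∈ ℝ^{mn}`. -/
def kron {m n : ℕ} (x : Euc m) (y : Euc n) : EuclideanSpace ℝ (Fin m × Fin n) :=
  (EuclideanSpace.equiv (Fin m × Fin n) ℝ).symm (fun p => x p.1 * y p.2)

/-- The primal feasible set `𝒫(C,D) = {A | ∃ x ∈ C \ {0}, Ax ∈ D°}`. -/
def primalSet {m n : ℕ} (C : Set (Euc m)) (D : Set (Euc n)) :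
    Set (Matrix (Fin n) (Fin m) ℝ) :=
  {A | ∃ x ∈ C, x ≠ 0 ∧ mulE A x ∈ polarCone D}

/-- The dual feasible set `𝒟(C,D) = {A | ∃ y ∈ D \ {0}, -Aᵀy ∈ C°}`. -/
def dualSet {m n : ℕ} (C : Set (Euc m)) (D : Set (Euc n)) :
    Set (Matrix (Fin n) (Fin m) ℝ) :=
  {A | ∃ y ∈ D, y ≠ 0 ∧ -(mulE A.transpose y) ∈ polarCone C}

/-- `K₂` is a `0`-contraction of `K₁`: there are generating sets `M₁` of `K₁`, `M₂` of `K₂`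
(i.e. `Kᵢ` is the closed convex hull of `Mᵢ`) and a surjection `φ : M₁ → M₂` that is
`1`-Lipschitz and norm-nonincreasing. -/
def IsZeroContractionOf {E₁ E₂ : Type*} [NormedAddCommGroup E₁] [NormedSpace ℝ E₁]
    [NormedAddCommGroup E₂] [NormedSpace ℝ E₂] (K₁ : Set E₁) (K₂ : Set E₂) : Prop :=
  ∃ (M₁ : Set E₁) (M₂ : Set E₂) (φ : E₁ → E₂),
    closure (convexHull ℝ M₁) = K₁ ∧ closure (convexHull ℝ M₂) = K₂ ∧
    φ '' M₁ = M₂ ∧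
    (∀ x ∈ M₁, ∀ x' ∈ M₁, ‖φ x - φ x'‖ ≤ ‖x - x'‖) ∧
    (∀ x ∈ M₁, ‖φ x‖ ≤ ‖x‖)

/-- The pair `(x, y)` regarded as an element of the Euclidean (ℓ²) product. -/
def pairL2 {m n : ℕ} (x : Euc m) (y : Euc n) : WithLp 2 (Euc m × Euc n) :=
  (WithLp.equiv 2 (Euc m × Euc n)).symm (x, y)

/-- The product `K × K'` as a subset of the Euclidean (ℓ²) product space. -/
def prodL2 {m n : ℕ} (K : Set (Euc m)) (K' : Set (Euc n)) : Set (WithLp 2 (Euc m × Euc n)) :=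
  {q | ((WithLp.equiv 2 (Euc m × Euc n)) q).1 ∈ K ∧ ((WithLp.equiv 2 (Euc m × Euc n)) q).2 ∈ K'}


/-- The standard Gaussian measure on `Fin M → ℝ`. -/
abbrev gaussPi (M : ℕ) : Measure (Fin M → ℝ) := Measure.pi fun _ => gaussianReal 0 1

lemma hasDerivAt_gaussianPDFReal (t : ℝ) :
    HasDerivAt (gaussianPDFReal 0 1) (-(t * gaussianPDFReal 0 1 t)) t := by
  have h : gaussianPDFReal 0 1 =
      fun t : ℝ => (Real.sqrt (2 * Real.pi))⁻¹ * Real.exp (-t ^ 2 / 2) := by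
    ext t; simp [gaussianPDFReal]
  rw [h]
  have h2 : HasDerivAt (fun t : ℝ => -t ^ 2 / 2) (-t) t := by
    exact ((hasDerivAt_pow 2 t).neg.div_const 2).congr_deriv (by norm_num; ring)
  refine (h2.exp.const_mul _).congr_deriv ?_
  ring

lemma integrable_gaussianPDFReal_mul {u : ℝ → ℝ} (hu : Integrable u (gaussianReal 0 1)) :
    Integrable (fun t => gaussianPDFReal 0 1 t * u t) := by
  rw [gaussianReal_of_var_ne_zero 0 one_ne_zero,
    integrable_withDensity_iff_integrable_smul' (measurable_gaussianPDF 0 1)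
      (Filter.Eventually.of_forall fun _ => gaussianPDF_lt_top)] at hu
  simpa [toReal_gaussianPDF] using hu

lemma integrable_id_gaussianReal : Integrable (fun t : ℝ => t) (gaussianReal 0 1) :=
  memLp_one_iff_integrable.1 (memLp_id_gaussianReal (μ := 0) (v := 1) 1)

/-- Gaussian integration by parts on the line. -/
lemma integral_mul_id_gaussianReal {W W' : ℝ → ℝ} {C : ℝ}
    (hW : ∀ t, HasDerivAt W (W' t) t) (hb : ∀ t, |W t| ≤ C) (hb' : ∀ t, |W' t| ≤ C) :
    ∫ t, W t * t ∂(gaussianReal 0 1) = ∫ t, W' t ∂(gaussianReal 0 1) := by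
  have hWc : Continuous W := continuous_iff_continuousAt.2 fun t => (hW t).continuousAt
  have hW'm : Measurable W' := by
    rw [show W' = deriv W from funext fun t => (hW t).deriv.symm]
    exact measurable_deriv W
  have i1 : Integrable W (gaussianReal 0 1) :=
    Integrable.of_bound hWc.aestronglyMeasurable C (Filter.Eventually.of_forall hb)
  have i2 : Integrable W' (gaussianReal 0 1) :=
    Integrable.of_bound hW'm.aestronglyMeasurable C (Filter.Eventually.of_forall hb')
  have i3 : Integrable (fun t => W t * t) (gaussianReal 0 1) :=
    integrable_id_gaussianReal.bdd_mul hWc.aestronglyMeasurable (Filter.Eventually.of_forall hb)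
  have key := integral_mul_deriv_eq_deriv_mul_of_integrable (u := W) (v := gaussianPDFReal 0 1)
    (fun t _ => hW t) (fun t _ => hasDerivAt_gaussianPDFReal t)
    ((integrable_gaussianPDFReal_mul i3).neg.congr
      (Filter.Eventually.of_forall fun t => by simp; ring))
    ((integrable_gaussianPDFReal_mul i2).congr
      (Filter.Eventually.of_forall fun t => by simp; ring))
    ((integrable_gaussianPDFReal_mul i1).congr
      (Filter.Eventually.of_forall fun t => by simp; ring))
  rw [integral_gaussianReal_eq_integral_smul one_ne_zero,
    integral_gaussianReal_eq_integral_smul one_ne_zero]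
  have e1 : ∫ t, gaussianPDFReal 0 1 t • (W t * t) =
      -∫ t, W t * -(t * gaussianPDFReal 0 1 t) := by
    rw [← integral_neg]
    congr 1; ext t; simp; ring
  rw [e1, key, neg_neg]
  congr 1; ext t; simp; ring

lemma integrable_eval_gaussPi {M : ℕ} (k : Fin M) :
    Integrable (fun g : Fin M → ℝ => g k) (gaussPi M) :=
  (measurePreserving_eval (fun _ : Fin M => gaussianReal 0 1) k).integrable_comp_of_integrable
    integrable_id_gaussianReal

/-- Gaussian integration by parts in one coordinate. -/
lemma integral_mul_eval_gaussPi {M : ℕ} (k : Fin M) {W W' : (Fin M → ℝ) → ℝ} {C : ℝ}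
    (hWc : Continuous W) (hW'c : Continuous W')
    (hW : ∀ g t, HasDerivAt (fun t => W (Function.update g k t)) (W' (Function.update g k t)) t)
    (hb : ∀ g, |W g| ≤ C) (hb' : ∀ g, |W' g| ≤ C) :
    ∫ g, W g * g k ∂(gaussPi M) = ∫ g, W' g ∂(gaussPi M) := by
  obtain _ | M := M
  · exact k.elim0
  have mp := (measurePreserving_piFinSuccAbove
    (fun _ : Fin (M + 1) => gaussianReal 0 1) k).symm
  have i1 : Integrable (fun g => W g * g k) (gaussPi (M + 1)) :=
    (integrable_eval_gaussPi k).bdd_mul hWc.aestronglyMeasurable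
      (Filter.Eventually.of_forall hb)
  have i2 : Integrable W' (gaussPi (M + 1)) :=
    Integrable.of_bound hW'c.aestronglyMeasurable C (Filter.Eventually.of_forall hb')
  rw [← mp.integral_comp', ← mp.integral_comp', integral_prod_symm, integral_prod_symm]
  · congr 1; ext r
    have h := fun t => hW (k.insertNth (α := fun _ => ℝ) 0 r) t
    simp only [Fin.update_insertNth] at h
    simpa [Fin.insertNthEquiv] using integral_mul_id_gaussianReal h (fun t => hb _) (fun t => hb' _)
  · exact mp.integrable_comp_of_integrable i2
  · exact mp.integrable_comp_of_integrable i1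

lemma measurePreserving_comp_gaussPi {M N : ℕ} {e : Fin N → Fin M}
    (he : Function.Injective e) :
    MeasurePreserving (fun g : Fin M → ℝ => g ∘ e) (gaussPi M) (gaussPi N) := by
  refine ⟨by fun_prop, ?_⟩
  have h := (iIndepFun_pi (μ := fun _ : Fin M => gaussianReal 0 1) (X := fun _ => id)
    (fun _ => aemeasurable_id)).precomp he
  have h2 := h.map_fun_eq_pi_map (fun i => (measurable_pi_apply (e i)).aemeasurable)
  refine h2.trans ?_
  congr 1; ext i : 1
  exact (measurePreserving_eval (fun _ : Fin M => gaussianReal 0 1) (e i)).map_eq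

namespace SmoothMinMax

set_option linter.unusedSectionVars false

variable {ι κ : Type*} [Fintype ι] [Fintype κ]

/-- The exponential sum of the `i`-th row. -/
def rowSum (z : ι × κ → ℝ) (i : ι) : ℝ := ∑ j, Real.exp (z (i, j))

/-- The sum of the inverse row sums. -/
def invSum (z : ι × κ → ℝ) : ℝ := ∑ i, (rowSum z i)⁻¹

/-- A smooth version of `max (log c) (min_i max_j z (i, j))`. -/
def smooth (c : ℝ) (z : ι × κ → ℝ) : ℝ := Real.log (c + (invSum z)⁻¹)

/-- The softmax weight of an entry within its row. -/
def entryWeight (z : ι × κ → ℝ) (a : ι × κ) : ℝ := Real.exp (z a) / rowSum z a.1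

/-- The softmin weight of a row. -/
def rowWeight (z : ι × κ → ℝ) (i : ι) : ℝ := (rowSum z i)⁻¹ / invSum z

/-- The weight of the soft minimum against the threshold `log c`. -/
def topWeight (c : ℝ) (z : ι × κ → ℝ) : ℝ := (1 + c * invSum z)⁻¹

/-- The gradient of `smooth c`. -/
def grad (c : ℝ) (z : ι × κ → ℝ) (a : ι × κ) : ℝ :=
  topWeight c z * rowWeight z a.1 * entryWeight z a

/-- The Hessian of `smooth c`. -/
def hess (c : ℝ) (z : ι × κ → ℝ) (a b : ι × κ) : ℝ :=
  grad c z a * ((2 - topWeight c z) * (rowWeight z b.1 * entryWeight z b)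
    - 2 * (if a.1 = b.1 then entryWeight z b else 0) + if a = b then 1 else 0)

section Basic

variable [Nonempty κ] {c : ℝ} (z : ι × κ → ℝ)

lemma rowSum_pos (i : ι) : 0 < rowSum z i :=
  Finset.sum_pos (fun _ _ => Real.exp_pos _) Finset.univ_nonempty

lemma entryWeight_nonneg (a : ι × κ) : 0 ≤ entryWeight z a :=
  div_nonneg (Real.exp_pos _).le (rowSum_pos z _).le

lemma sum_entryWeight (i : ι) : ∑ j, entryWeight z (i, j) = 1 := by
  simp only [entryWeight, ← Finset.sum_div]
  exact div_self (rowSum_pos z i).ne'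

lemma entryWeight_le_one (a : ι × κ) : entryWeight z a ≤ 1 := by
  rw [← sum_entryWeight z a.1]
  exact Finset.single_le_sum (f := fun j => entryWeight z (a.1, j))
    (fun j _ => entryWeight_nonneg z _) (Finset.mem_univ a.2)

variable [Nonempty ι]

lemma invSum_pos : 0 < invSum z :=
  Finset.sum_pos (fun i _ => inv_pos.2 (rowSum_pos z i)) Finset.univ_nonempty

lemma rowWeight_nonneg (i : ι) : 0 ≤ rowWeight z i :=
  div_nonneg (inv_pos.2 (rowSum_pos z i)).le (invSum_pos z).le

lemma sum_rowWeight : ∑ i, rowWeight z i = 1 := by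
  simp only [rowWeight, ← Finset.sum_div]
  exact div_self (invSum_pos z).ne'

lemma rowWeight_le_one (i : ι) : rowWeight z i ≤ 1 := by
  rw [← sum_rowWeight z]
  exact Finset.single_le_sum (fun i _ => rowWeight_nonneg z i) (Finset.mem_univ i)

lemma one_add_mul_invSum_pos (hc : 0 < c) : 0 < 1 + c * invSum z := by
  have := mul_pos hc (invSum_pos z)
  linarith

lemma topWeight_nonneg (hc : 0 < c) : 0 ≤ topWeight c z :=
  (inv_pos.2 (one_add_mul_invSum_pos z hc)).le

lemma topWeight_le_one (hc : 0 < c) : topWeight c z ≤ 1 :=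
  inv_le_one_of_one_le₀ (by have := mul_pos hc (invSum_pos z); linarith)

lemma grad_nonneg (hc : 0 < c) (a : ι × κ) : 0 ≤ grad c z a :=
  mul_nonneg (mul_nonneg (topWeight_nonneg z hc) (rowWeight_nonneg z _)) (entryWeight_nonneg z _)

lemma grad_le_one (hc : 0 < c) (a : ι × κ) : grad c z a ≤ 1 :=
  mul_le_one₀ (mul_le_one₀ (topWeight_le_one z hc) (rowWeight_nonneg z _) (rowWeight_le_one z _))
    (entryWeight_nonneg z _) (entryWeight_le_one z _)

lemma abs_grad_le (hc : 0 < c) (a : ι × κ) : |grad c z a| ≤ 1 := by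
  rw [abs_of_nonneg (grad_nonneg z hc a)]
  exact grad_le_one z hc a

lemma abs_hess_le (hc : 0 < c) (a b : ι × κ) : |hess c z a b| ≤ 5 := by
  rw [hess, abs_mul]
  have h1 := abs_grad_le z hc a
  have hp := entryWeight_nonneg z b
  have hp' := entryWeight_le_one z b
  have hr := topWeight_nonneg z hc
  have hr' := topWeight_le_one z hc
  have hqp : 0 ≤ rowWeight z b.1 * entryWeight z b := mul_nonneg (rowWeight_nonneg z _) hp
  have hqp' : rowWeight z b.1 * entryWeight z b ≤ 1 :=
    mul_le_one₀ (rowWeight_le_one z _) hp hp'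
  have h2 : |(2 - topWeight c z) * (rowWeight z b.1 * entryWeight z b)
    - 2 * (if a.1 = b.1 then entryWeight z b else 0) + if a = b then 1 else 0| ≤ 5 := by
    rw [abs_le]
    constructor <;> split_ifs <;> nlinarith
  calc _ ≤ 1 * 5 := mul_le_mul h1 h2 (abs_nonneg _) zero_le_one
    _ = 5 := by norm_num

lemma hess_comm (a b : ι × κ) : hess c z a b = hess c z b a := by
  by_cases hab : a = b
  · rw [hab]
  by_cases h : a.1 = b.1
  · simp only [hess, grad, hab, Ne.symm hab, h, if_true, if_false]; ring
  · simp only [hess, grad, hab, Ne.symm hab, h, Ne.symm h, if_false]; ring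

lemma hess_nonpos_of_same_row (hc : 0 < c) {a b : ι × κ} (hab : a ≠ b) (h : a.1 = b.1) :
    hess c z a b ≤ 0 := by
  simp only [hess, hab, h, if_true, if_false]
  refine mul_nonpos_of_nonneg_of_nonpos (grad_nonneg z hc a) ?_
  have hp := entryWeight_nonneg z b
  have hr := topWeight_nonneg z hc
  have hqp : 0 ≤ rowWeight z b.1 * entryWeight z b := mul_nonneg (rowWeight_nonneg z _) hp
  have := mul_le_of_le_one_left hp (rowWeight_le_one z b.1)
  nlinarith

lemma hess_nonneg_of_ne_row (hc : 0 < c) {a b : ι × κ} (h : a.1 ≠ b.1) :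
    0 ≤ hess c z a b := by
  have hab : a ≠ b := fun e => h (by rw [e])
  simp only [hess, hab, h, if_false]
  refine mul_nonneg (grad_nonneg z hc a) ?_
  have hr := topWeight_le_one z hc
  have hqp : 0 ≤ rowWeight z b.1 * entryWeight z b :=
    mul_nonneg (rowWeight_nonneg z _) (entryWeight_nonneg z b)
  nlinarith

lemma sum_hess_mul (a : ι × κ) (v : ι × κ → ℝ) :
    ∑ b, hess c z a b * v b = grad c z a *
      ((2 - topWeight c z) * ∑ i, rowWeight z i * ∑ j, entryWeight z (i, j) * v (i, j)
        - 2 * ∑ j, entryWeight z (a.1, j) * v (a.1, j) + v a) := by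
  have h1 : ∑ b : ι × κ, (if a.1 = b.1 then entryWeight z b else 0) * v b =
      ∑ j, entryWeight z (a.1, j) * v (a.1, j) := by
    rw [Fintype.sum_prod_type, Finset.sum_eq_single a.1]
    · simp
    · intro i _ hi; simp [Ne.symm hi]
    · simp
  have h2 : ∑ b : ι × κ, (if a = b then (1 : ℝ) else 0) * v b = v a := by simp
  have h3 : ∑ b : ι × κ, rowWeight z b.1 * entryWeight z b * v b =
      ∑ i, rowWeight z i * ∑ j, entryWeight z (i, j) * v (i, j) := by
    rw [Fintype.sum_prod_type]
    simp only [Finset.mul_sum, mul_assoc]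
  rw [← h1, ← h3, ← h2]
  simp only [Finset.mul_sum, ← Finset.sum_sub_distrib, ← Finset.sum_add_distrib]
  refine Finset.sum_congr rfl fun b _ => ?_
  simp only [hess]; ring

lemma sum_hess_nonneg (hc : 0 < c) (a : ι × κ) : 0 ≤ ∑ b, hess c z a b := by
  have h := sum_hess_mul (c := c) z a 1
  simp only [Pi.one_apply, mul_one, sum_entryWeight, sum_rowWeight] at h
  rw [h]
  have := topWeight_le_one z hc
  exact mul_nonneg (grad_nonneg z hc a) (by linarith)

/-- The second-order form of the comparison: `D` are differences of squared distances,
`d` are differences of squared norms. -/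
lemma sum_hess_mul_nonneg (hc : 0 < c) {C D : ι × κ → ι × κ → ℝ} {d : ι × κ → ℝ}
    (hC : ∀ a b, 2 * C a b = d a + d b - D a b) (hd : ∀ a, 0 ≤ d a) (hD0 : ∀ a, D a a = 0)
    (hD1 : ∀ a b : ι × κ, a.1 = b.1 → 0 ≤ D a b)
    (hD2 : ∀ a b : ι × κ, a.1 ≠ b.1 → D a b ≤ 0) :
    0 ≤ ∑ a, ∑ b, hess c z a b * C a b := by
  have e1 : ∑ a, ∑ b, hess c z a b * d b = ∑ a, ∑ b, hess c z a b * d a := by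
    rw [Finset.sum_comm]
    simp only [hess_comm z]
  have e2 : 2 * ∑ a, ∑ b, hess c z a b * C a b =
      2 * (∑ a, (∑ b, hess c z a b) * d a) + ∑ a, ∑ b, -(hess c z a b * D a b) := by
    have : ∀ a b, 2 * (hess c z a b * C a b) =
        hess c z a b * d a + hess c z a b * d b + -(hess c z a b * D a b) := fun a b => by
      linear_combination (hess c z a b) * hC a b
    simp only [Finset.mul_sum (a := (2 : ℝ)), this, Finset.sum_add_distrib, e1, Finset.sum_mul]
    simp only [← Finset.mul_sum]
    ring
  have e3 : 0 ≤ ∑ a, (∑ b, hess c z a b) * d a :=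
    Finset.sum_nonneg fun a _ => mul_nonneg (sum_hess_nonneg z hc a) (hd a)
  have e4 : 0 ≤ ∑ a, ∑ b, -(hess c z a b * D a b) := by
    refine Finset.sum_nonneg fun a _ => Finset.sum_nonneg fun b _ => ?_
    rw [neg_nonneg]
    by_cases hab : a = b
    · simp [hab, hD0]
    by_cases h : a.1 = b.1
    · exact mul_nonpos_of_nonpos_of_nonneg (hess_nonpos_of_same_row z hc hab h) (hD1 a b h)
    · exact mul_nonpos_of_nonneg_of_nonpos (hess_nonneg_of_ne_row z hc h) (hD2 a b h)
  linarith

end Basic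

section Deriv

variable [Nonempty κ] {c t : ℝ} {u : ℝ → ι × κ → ℝ} {u' : ι × κ → ℝ}

lemma hasDerivAt_rowSum (hu : ∀ a, HasDerivAt (fun t => u t a) (u' a) t) (i : ι) :
    HasDerivAt (fun t => rowSum (u t) i)
      (rowSum (u t) i * ∑ j, entryWeight (u t) (i, j) * u' (i, j)) t := by
  refine (HasDerivAt.fun_sum fun j _ => (hu (i, j)).exp).congr_deriv ?_
  rw [Finset.mul_sum]
  refine Finset.sum_congr rfl fun j _ => ?_
  have := (rowSum_pos (u t) i).ne'
  simp only [entryWeight]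
  field_simp

variable [Nonempty ι]

lemma hasDerivAt_invSum (hu : ∀ a, HasDerivAt (fun t => u t a) (u' a) t) :
    HasDerivAt (fun t => invSum (u t)) (-(invSum (u t) *
      ∑ i, rowWeight (u t) i * ∑ j, entryWeight (u t) (i, j) * u' (i, j))) t := by
  refine (HasDerivAt.fun_sum fun i _ =>
    (hasDerivAt_rowSum hu i).fun_inv (rowSum_pos (u t) i).ne').congr_deriv ?_
  rw [Finset.mul_sum, ← Finset.sum_neg_distrib]
  refine Finset.sum_congr rfl fun i _ => ?_
  have := (rowSum_pos (u t) i).ne'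
  have := (invSum_pos (u t)).ne'
  simp only [rowWeight]
  field_simp

lemma hasDerivAt_smooth (hc : 0 < c) (hu : ∀ a, HasDerivAt (fun t => u t a) (u' a) t) :
    HasDerivAt (fun t => smooth c (u t)) (∑ a, grad c (u t) a * u' a) t := by
  have hQ := invSum_pos (u t)
  have hpos : c + (invSum (u t))⁻¹ ≠ 0 := (add_pos hc (inv_pos.2 hQ)).ne'
  refine ((((hasDerivAt_invSum hu).fun_inv hQ.ne').const_add c).log hpos).congr_deriv ?_
  have e : ∑ a, grad c (u t) a * u' a = topWeight c (u t) *
      ∑ i, rowWeight (u t) i * ∑ j, entryWeight (u t) (i, j) * u' (i, j) := by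
    rw [Fintype.sum_prod_type]
    simp only [grad, Finset.mul_sum, mul_assoc]
  rw [e, topWeight]
  have := (one_add_mul_invSum_pos (u t) hc).ne'
  have h3 : c * invSum (u t) + 1 ≠ 0 := by rwa [add_comm]
  field_simp
  ring

lemma hasDerivAt_grad (hc : 0 < c) (hu : ∀ a, HasDerivAt (fun t => u t a) (u' a) t)
    (a : ι × κ) :
    HasDerivAt (fun t => grad c (u t) a) (∑ b, hess c (u t) a b * u' b) t := by
  have hQ := (invSum_pos (u t)).ne'
  have hS := (rowSum_pos (u t) a.1).ne'
  have h1 := (one_add_mul_invSum_pos (u t) hc).ne'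
  have dr := (((hasDerivAt_invSum hu).const_mul c).const_add 1).fun_inv h1
  have dq := ((hasDerivAt_rowSum hu a.1).fun_inv hS).fun_div (hasDerivAt_invSum hu) hQ
  have dp := (hu a).exp.fun_div (hasDerivAt_rowSum hu a.1) hS
  refine ((dr.fun_mul dq).fun_mul dp).congr_deriv ?_
  rw [sum_hess_mul, grad, topWeight, rowWeight, entryWeight]
  generalize (∑ i, rowWeight (u t) i * ∑ j, entryWeight (u t) (i, j) * u' (i, j)) = A
  generalize (∑ j, entryWeight (u t) (a.1, j) * u' (a.1, j)) = P
  field_simp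
  ring

end Deriv

section Continuity

variable [Nonempty κ] [Nonempty ι] {c : ℝ}

lemma continuous_rowSum (i : ι) : Continuous fun z : ι × κ → ℝ => rowSum z i := by
  unfold rowSum; fun_prop

lemma continuous_invSum : Continuous fun z : ι × κ → ℝ => invSum z :=
  continuous_finsetSum _ fun i _ => (continuous_rowSum i).inv₀ fun z => (rowSum_pos z i).ne'

lemma continuous_smooth (hc : 0 < c) : Continuous fun z : ι × κ → ℝ => smooth c z :=
  ((continuous_invSum.inv₀ fun z => (invSum_pos z).ne').const_add c).log
    fun z => (add_pos hc (inv_pos.2 (invSum_pos z))).ne'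

lemma continuous_entryWeight (a : ι × κ) : Continuous fun z : ι × κ → ℝ => entryWeight z a :=
  (Real.continuous_exp.comp (continuous_apply a)).div (continuous_rowSum a.1)
    fun z => (rowSum_pos z a.1).ne'

lemma continuous_rowWeight (i : ι) : Continuous fun z : ι × κ → ℝ => rowWeight z i :=
  ((continuous_rowSum i).inv₀ fun z => (rowSum_pos z i).ne').div continuous_invSum
    fun z => (invSum_pos z).ne'

lemma continuous_topWeight (hc : 0 < c) : Continuous fun z : ι × κ → ℝ => topWeight c z :=
  ((continuous_invSum.const_mul c).const_add 1).inv₀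
    fun z => (one_add_mul_invSum_pos z hc).ne'

lemma continuous_grad (hc : 0 < c) (a : ι × κ) :
    Continuous fun z : ι × κ → ℝ => grad c z a :=
  ((continuous_topWeight hc).mul (continuous_rowWeight a.1)).mul (continuous_entryWeight a)

lemma continuous_hess (hc : 0 < c) (a b : ι × κ) :
    Continuous fun z : ι × κ → ℝ => hess c z a b := by
  have h1 := continuous_grad (ι := ι) (κ := κ) hc a
  have h2 := continuous_topWeight (ι := ι) (κ := κ) hc
  have h3 := continuous_rowWeight (ι := ι) (κ := κ) b.1
  have h4 := continuous_entryWeight (ι := ι) (κ := κ) b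
  unfold hess
  split_ifs <;> fun_prop

end Continuity

section Approximation

variable [Nonempty κ] [Nonempty ι]

lemma abs_smooth_sub_le (s : ℝ) (z : ι × κ → ℝ) :
    |smooth (Real.exp s) z - max s (⨅ i, ⨆ j, z (i, j))| ≤
      Real.log (Fintype.card ι) + Real.log (Fintype.card κ + 1) := by
  set R : ι → ℝ := fun i => ⨆ j, z (i, j) with hR
  set T : ℝ := ⨅ i, R i with hT
  have hm : (1 : ℝ) ≤ Fintype.card ι := by exact_mod_cast Fintype.card_pos
  have hn : (1 : ℝ) ≤ Fintype.card κ := by exact_mod_cast Fintype.card_pos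
  have hS1 : ∀ i, Real.exp (R i) ≤ rowSum z i := fun i => by
    obtain ⟨j, hj⟩ := exists_eq_ciSup_of_finite (f := fun j => z (i, j))
    rw [hR]; simp only
    rw [← hj]
    exact Finset.single_le_sum (f := fun j => Real.exp (z (i, j)))
      (fun _ _ => (Real.exp_pos _).le) (Finset.mem_univ j)
  have hS2 : ∀ i, rowSum z i ≤ Fintype.card κ * Real.exp (R i) := fun i => by
    have : ∀ j ∈ Finset.univ, Real.exp (z (i, j)) ≤ Real.exp (R i) := fun j _ =>
      Real.exp_le_exp.2 (le_ciSup (f := fun j => z (i, j)) (Set.finite_range _).bddAbove j)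
    simpa [rowSum] using Finset.sum_le_sum this
  have hQ1 : invSum z ≤ Fintype.card ι * (Real.exp T)⁻¹ := by
    have : ∀ i ∈ Finset.univ, (rowSum z i)⁻¹ ≤ (Real.exp T)⁻¹ := fun i _ =>
      inv_anti₀ (Real.exp_pos _) ((Real.exp_le_exp.2
        (ciInf_le (Set.finite_range _).bddBelow i)).trans (hS1 i))
    simpa [invSum] using Finset.sum_le_sum this
  have hQ2 : (Fintype.card κ * Real.exp T)⁻¹ ≤ invSum z := by
    obtain ⟨i, hi⟩ := exists_eq_ciInf_of_finite (f := R)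
    have h1 : (rowSum z i)⁻¹ ≤ invSum z := Finset.single_le_sum (f := fun i => (rowSum z i)⁻¹)
      (fun i _ => (inv_pos.2 (rowSum_pos z i)).le) (Finset.mem_univ i)
    refine (inv_anti₀ (rowSum_pos z i) ?_).trans h1
    rw [hT, ← hi]
    exact hS2 i
  have hI1 : (invSum z)⁻¹ ≤ Fintype.card κ * Real.exp T := by
    rw [inv_le_comm₀ (invSum_pos z) (by positivity)]; exact hQ2
  have hI2 : Real.exp T ≤ Fintype.card ι * (invSum z)⁻¹ := by
    rw [← div_eq_mul_inv, le_div_iff₀ (invSum_pos z)]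
    calc Real.exp T * invSum z ≤ Real.exp T * (Fintype.card ι * (Real.exp T)⁻¹) := by gcongr
      _ = Fintype.card ι := by field_simp
  have hpos : 0 < Real.exp s + (invSum z)⁻¹ :=
    add_pos (Real.exp_pos _) (inv_pos.2 (invSum_pos z))
  have l1 := Real.log_nonneg hm
  have l2 : 0 ≤ Real.log ((Fintype.card κ : ℝ) + 1) := Real.log_nonneg (by linarith)
  have hs : Real.exp s ≤ Real.exp (max s T) := Real.exp_le_exp.2 (le_max_left _ _)
  have ht : Real.exp T ≤ Real.exp (max s T) := Real.exp_le_exp.2 (le_max_right _ _)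
  have up : smooth (Real.exp s) z ≤ Real.log (Fintype.card κ + 1) + max s T := by
    rw [smooth, Real.log_le_iff_le_exp hpos, Real.exp_add, Real.exp_log (by linarith)]
    nlinarith
  have lo : max s T ≤ Real.log (Fintype.card ι) + smooth (Real.exp s) z := by
    rw [smooth, ← Real.log_mul (by linarith) hpos.ne', Real.le_log_iff_exp_le (by positivity)]
    have := inv_pos.2 (invSum_pos z)
    have := Real.exp_pos s
    rcases max_choice s T with h | h <;> rw [h] <;> nlinarith
  rw [abs_le]
  constructor <;> linarith

lemma abs_max_iInf_iSup_le (s : ℝ) (z : ι × κ → ℝ) :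
    |max s (⨅ i, ⨆ j, z (i, j))| ≤ |s| + ∑ a, |z a| := by
  obtain ⟨i, hi⟩ := exists_eq_ciInf_of_finite (f := fun i => ⨆ j, z (i, j))
  obtain ⟨j, hj⟩ := exists_eq_ciSup_of_finite (f := fun j => z (i, j))
  rw [← hi, ← hj]
  have h1 : |z (i, j)| ≤ ∑ a, |z a| :=
    Finset.single_le_sum (f := fun a => |z a|) (fun a _ => abs_nonneg _) (Finset.mem_univ (i, j))
  have h2 := abs_nonneg (z (i, j))
  have h3 := abs_nonneg s
  exact abs_max_le_max_abs_abs.trans (max_le (by linarith) (by linarith))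

end Approximation

section Comparison

variable [Nonempty ι] [Nonempty κ] {M N : ℕ} {c : ℝ}

/-- The family of linear forms `g ↦ ⟨z a, g⟩`. -/
def lin {α : Type*} (z : α → Fin M → ℝ) (g : Fin M → ℝ) (a : α) : ℝ := ∑ k, z a k * g k

lemma continuous_lin {α : Type*} (z : α → Fin M → ℝ) : Continuous (lin z) := by
  unfold lin; fun_prop

lemma integrable_lin {α : Type*} (z : α → Fin M → ℝ) (a : α) :
    Integrable (fun g => lin z g a) (gaussPi M) :=
  integrable_finsetSum _ fun k _ => (integrable_eval_gaussPi k).const_mul _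

lemma hasDerivAt_lin_update {α : Type*} (z : α → Fin M → ℝ) (g : Fin M → ℝ) (k : Fin M) (t : ℝ)
    (a : α) : HasDerivAt (fun t => lin z (Function.update g k t) a) (z a k) t := by
  refine (HasDerivAt.fun_sum fun l _ =>
    ((hasDerivAt_pi.1 (hasDerivAt_update g k t) l).const_mul (z a l))).congr_deriv ?_
  simp [Pi.single_apply]

lemma integrable_max_iInf_iSup_lin (s : ℝ) (z : ι × κ → Fin M → ℝ) :
    Integrable (fun g => max s (⨅ i, ⨆ j, lin z g (i, j))) (gaussPi M) := by
  refine Integrable.mono' (g := fun g => |s| + ∑ a, |lin z g a|)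
    ((integrable_const _).add (integrable_finsetSum _ fun a _ => (integrable_lin z a).abs)) ?_
    (Filter.Eventually.of_forall fun g => abs_max_iInf_iSup_le s (lin z g))
  have h : ∀ a, Measurable fun g => lin z g a := fun a =>
    ((continuous_apply a).comp (continuous_lin z)).measurable
  exact (measurable_const.max
    (Measurable.iInf fun i => Measurable.iSup fun j => h (i, j))).aestronglyMeasurable

lemma integrable_smooth_lin (hc : 0 < c) (z : ι × κ → Fin M → ℝ) :
    Integrable (fun g => smooth c (lin z g)) (gaussPi M) := by
  have h : Integrable (fun g => smooth c (lin z g) -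
      max (Real.log c) (⨅ i, ⨆ j, lin z g (i, j))) (gaussPi M) := by
    refine Integrable.of_bound ?_ (Real.log (Fintype.card ι) + Real.log (Fintype.card κ + 1))
      (Filter.Eventually.of_forall fun g => ?_)
    · exact ((continuous_smooth hc).comp (continuous_lin z)).aestronglyMeasurable.sub
        (integrable_max_iInf_iSup_lin _ z).aestronglyMeasurable
    · have := abs_smooth_sub_le (Real.log c) (lin z g)
      rwa [Real.exp_log hc] at this
  exact (h.add (integrable_max_iInf_iSup_lin (Real.log c) z)).congr
    (Filter.Eventually.of_forall fun g => sub_add_cancel _ _)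

lemma integral_grad_mul_eval (hc : 0 < c) (z : ι × κ → Fin M → ℝ) (a : ι × κ) (k : Fin M) :
    ∫ g, grad c (lin z g) a * g k ∂(gaussPi M) =
      ∫ g, ∑ b, hess c (lin z g) a b * z b k ∂(gaussPi M) := by
  have hpos : 0 ≤ ∑ b, 5 * |z b k| := Finset.sum_nonneg fun b _ => by positivity
  refine integral_mul_eval_gaussPi k (C := 1 + ∑ b, 5 * |z b k|)
    ((continuous_grad hc a).comp (continuous_lin z))
    (continuous_finsetSum _ fun b _ =>
      ((continuous_hess hc a b).comp (continuous_lin z)).mul_const _)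
    (fun g t => hasDerivAt_grad hc (fun b => hasDerivAt_lin_update z g k t b) a)
    (fun g => (abs_grad_le _ hc a).trans (by linarith)) (fun g => ?_)
  refine (Finset.abs_sum_le_sum_abs _ _).trans ?_
  refine le_trans (Finset.sum_le_sum fun b _ => ?_) (le_add_of_nonneg_left zero_le_one)
  rw [abs_mul]
  exact mul_le_mul_of_nonneg_right (abs_hess_le _ hc a b) (abs_nonneg _)

/-- Gaussian integration by parts for the gradient of `smooth c` along linear forms. -/
lemma integral_sum_grad_mul_lin (hc : 0 < c) (z w : ι × κ → Fin M → ℝ) :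
    ∫ g, ∑ a, grad c (lin z g) a * lin w g a ∂(gaussPi M) =
      ∫ g, ∑ a, ∑ b, hess c (lin z g) a b * ∑ k, w a k * z b k ∂(gaussPi M) := by
  have ig : ∀ a k, Integrable (fun g => w a k * (grad c (lin z g) a * g k)) (gaussPi M) :=
    fun a k => ((integrable_eval_gaussPi k).bdd_mul
      ((continuous_grad hc a).comp (continuous_lin z)).aestronglyMeasurable
      (Filter.Eventually.of_forall fun g => abs_grad_le _ hc a)).const_mul _
  have ih : ∀ a b, Integrable (fun g => hess c (lin z g) a b) (gaussPi M) := fun a b =>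
    Integrable.of_bound ((continuous_hess hc a b).comp (continuous_lin z)).aestronglyMeasurable 5
      (Filter.Eventually.of_forall fun g => abs_hess_le _ hc a b)
  have e1 : ∀ g, ∑ a, grad c (lin z g) a * lin w g a =
      ∑ a, ∑ k, w a k * (grad c (lin z g) a * g k) := fun g =>
    Finset.sum_congr rfl fun a _ => by
      rw [lin, Finset.mul_sum]
      exact Finset.sum_congr rfl fun k _ => by ring
  simp only [e1]
  rw [integral_finsetSum _ fun a _ => integrable_finsetSum _ fun k _ => ig a k,
    integral_finsetSum _ fun a _ => integrable_finsetSum _ fun b _ => (ih a b).mul_const _]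
  refine Finset.sum_congr rfl fun a _ => ?_
  rw [integral_finsetSum _ fun k _ => ig a k,
    integral_finsetSum _ fun b _ => (ih a b).mul_const _]
  simp only [integral_const_mul, integral_mul_const, integral_grad_mul_eval hc]
  simp only [integral_finsetSum _ fun b _ => (ih a b).mul_const _, integral_mul_const,
    Finset.mul_sum]
  rw [Finset.sum_comm]
  exact Finset.sum_congr rfl fun b _ => Finset.sum_congr rfl fun k _ => by ring

/-- The rotation from the family `v` to the family `w`. -/
def rot {α : Type*} (v w : α → Fin M → ℝ) (θ : ℝ) (a : α) (k : Fin M) : ℝ :=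
  Real.cos θ * v a k + Real.sin θ * w a k

/-- The velocity of `rot`. -/
def rotDeriv {α : Type*} (v w : α → Fin M → ℝ) (θ : ℝ) (a : α) (k : Fin M) : ℝ :=
  -Real.sin θ * v a k + Real.cos θ * w a k

lemma lin_rotDeriv {α : Type*} (v w : α → Fin M → ℝ) (θ : ℝ) (g : Fin M → ℝ) (a : α) :
    lin (rotDeriv v w θ) g a = -Real.sin θ * lin v g a + Real.cos θ * lin w g a := by
  simp only [lin, rotDeriv, Finset.mul_sum, ← Finset.sum_add_distrib]
  exact Finset.sum_congr rfl fun k _ => by ring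

lemma hasDerivAt_lin_rot {α : Type*} (v w : α → Fin M → ℝ) (θ : ℝ) (g : Fin M → ℝ) (a : α) :
    HasDerivAt (fun θ => lin (rot v w θ) g a) (lin (rotDeriv v w θ) g a) θ :=
  HasDerivAt.fun_sum fun _ _ => (((Real.hasDerivAt_cos θ).mul_const _).add
    ((Real.hasDerivAt_sin θ).mul_const _)).mul_const _

lemma hasDerivAt_integral_smooth (hc : 0 < c) (v w : ι × κ → Fin M → ℝ) (θ : ℝ) :
    HasDerivAt (fun θ => ∫ g, smooth c (lin (rot v w θ) g) ∂(gaussPi M))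
      (∫ g, ∑ a, grad c (lin (rot v w θ) g) a * lin (rotDeriv v w θ) g a ∂(gaussPi M)) θ := by
  refine (hasDerivAt_integral_of_dominated_loc_of_deriv_le (s := Set.univ)
    (F' := fun θ g => ∑ a, grad c (lin (rot v w θ) g) a * lin (rotDeriv v w θ) g a)
    (bound := fun g => ∑ a, (|lin v g a| + |lin w g a|)) Filter.univ_mem
    (Filter.Eventually.of_forall fun θ => (integrable_smooth_lin hc _).aestronglyMeasurable)
    (integrable_smooth_lin hc _) ?_ (Filter.Eventually.of_forall fun g θ _ => ?_)
    (integrable_finsetSum _ fun a _ => (integrable_lin v a).abs.add (integrable_lin w a).abs)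
    (Filter.Eventually.of_forall fun g θ _ =>
      hasDerivAt_smooth hc fun a => hasDerivAt_lin_rot v w θ g a)).2
  · exact (continuous_finsetSum _ fun a _ =>
      ((continuous_grad hc a).comp (continuous_lin _)).mul
        ((continuous_apply a).comp (continuous_lin _))).aestronglyMeasurable
  · refine (Finset.abs_sum_le_sum_abs _ _).trans (Finset.sum_le_sum fun a _ => ?_)
    rw [abs_mul]
    refine (mul_le_of_le_one_left (abs_nonneg _) (abs_grad_le _ hc a)).trans ?_
    rw [lin_rotDeriv]
    refine (abs_add_le _ _).trans (add_le_add ?_ ?_) <;> rw [abs_mul]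
    · exact mul_le_of_le_one_left (abs_nonneg _) (by simpa using Real.abs_sin_le_one θ)
    · exact mul_le_of_le_one_left (abs_nonneg _) (Real.abs_cos_le_one θ)

/-- Gordon's comparison for the smoothed thresholded min-max. -/
theorem integral_smooth_le (hc : 0 < c) (x y : ι × κ → Fin N → ℝ)
    (hne : ∀ a b : ι × κ, a.1 ≠ b.1 →
      ∑ k, (x a k - x b k) ^ 2 ≤ ∑ k, (y a k - y b k) ^ 2)
    (heq : ∀ a b : ι × κ, a.1 = b.1 →
      ∑ k, (y a k - y b k) ^ 2 ≤ ∑ k, (x a k - x b k) ^ 2)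
    (hnorm : ∀ a, ∑ k, y a k ^ 2 ≤ ∑ k, x a k ^ 2) :
    ∫ g, smooth c (lin y g) ∂(gaussPi N) ≤ ∫ g, smooth c (lin x g) ∂(gaussPi N) := by
  set v : ι × κ → Fin (N + N) → ℝ := fun a => Fin.append 0 (y a) with hv
  set w : ι × κ → Fin (N + N) → ℝ := fun a => Fin.append (x a) 0 with hw
  set Φ : ℝ → ℝ := fun θ => ∫ g, smooth c (lin (rot v w θ) g) ∂(gaussPi (N + N)) with hΦ
  have h0 : Φ 0 = ∫ g, smooth c (lin y g) ∂(gaussPi N) := by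
    have mp := measurePreserving_comp_gaussPi (e := fun k : Fin N => Fin.natAdd N k)
      (Fin.natAdd_injective N N)
    have hcont : Continuous fun g => smooth c (lin y g) :=
      (continuous_smooth hc).comp (continuous_lin y)
    have e : ∀ g, lin (rot v w 0) g = lin y (g ∘ fun k : Fin N => Fin.natAdd N k) := fun g => by
      ext a
      simp [lin, rot, hv, hw, Fin.sum_univ_add, -Fin.natAdd_eq_addNat]
    simp only [hΦ, e]
    rw [← mp.map_eq, integral_map mp.measurable.aemeasurable hcont.aestronglyMeasurable]
  have h1 : Φ (Real.pi / 2) = ∫ g, smooth c (lin x g) ∂(gaussPi N) := by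
    have mp := measurePreserving_comp_gaussPi (e := fun k : Fin N => Fin.castAdd N k)
      (Fin.castAdd_injective N N)
    have hcont : Continuous fun g => smooth c (lin x g) :=
      (continuous_smooth hc).comp (continuous_lin x)
    have e : ∀ g, lin (rot v w (Real.pi / 2)) g = lin x (g ∘ fun k : Fin N => Fin.castAdd N k) := fun g => by
      ext a
      simp [lin, rot, hv, hw, Fin.sum_univ_add, -Fin.natAdd_eq_addNat]
    simp only [hΦ, e]
    rw [← mp.map_eq, integral_map mp.measurable.aemeasurable hcont.aestronglyMeasurable]
  have hinner : ∀ θ a b, ∑ k, rotDeriv v w θ a k * rot v w θ b k =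
      (Real.sin θ * Real.cos θ) * (∑ k, x a k * x b k - ∑ k, y a k * y b k) := by
    intro θ a b
    simp only [rot, rotDeriv, hv, hw, Fin.sum_univ_add, Fin.append_left, Fin.append_right,
      Pi.zero_apply, mul_sub, Finset.mul_sum]
    rw [sub_eq_add_neg, ← Finset.sum_neg_distrib]
    congr 1 <;> exact Finset.sum_congr rfl fun k _ => by ring
  have hderiv := hasDerivAt_integral_smooth hc v w
  have hmono : MonotoneOn Φ (Set.Icc 0 (Real.pi / 2)) := by
    refine monotoneOn_of_deriv_nonneg (convex_Icc _ _)
      (fun θ _ => (hderiv θ).continuousAt.continuousWithinAt)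
      (fun θ _ => (hderiv θ).differentiableAt.differentiableWithinAt) fun θ hθ => ?_
    rw [interior_Icc] at hθ
    rw [(hderiv θ).deriv, integral_sum_grad_mul_lin hc]
    refine integral_nonneg fun g => ?_
    have hsc : 0 ≤ Real.sin θ * Real.cos θ := mul_nonneg
      (Real.sin_nonneg_of_nonneg_of_le_pi hθ.1.le (by linarith [hθ.2, Real.pi_pos]))
      (Real.cos_nonneg_of_neg_pi_div_two_le_of_le (by linarith [hθ.1, Real.pi_pos]) hθ.2.le)
    have key := sum_hess_mul_nonneg (lin (rot v w θ) g) hc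
      (C := fun a b => ∑ k, x a k * x b k - ∑ k, y a k * y b k)
      (D := fun a b => ∑ k, (x a k - x b k) ^ 2 - ∑ k, (y a k - y b k) ^ 2)
      (d := fun a => ∑ k, x a k ^ 2 - ∑ k, y a k ^ 2)
      (fun a b => by
        simp only [Finset.mul_sum, ← Finset.sum_sub_distrib, ← Finset.sum_add_distrib]
        exact Finset.sum_congr rfl fun k _ => by ring)
      (fun a => sub_nonneg.2 (hnorm a)) (fun a => by simp)
      (fun a b h => sub_nonneg.2 (heq a b h)) (fun a b h => sub_nonpos.2 (hne a b h))
    have e : ∑ a, ∑ b, hess c (lin (rot v w θ) g) a b *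
        ∑ k, rotDeriv v w θ a k * rot v w θ b k = (Real.sin θ * Real.cos θ) *
        ∑ a, ∑ b, hess c (lin (rot v w θ) g) a b *
          (∑ k, x a k * x b k - ∑ k, y a k * y b k) := by
      simp only [hinner, Finset.mul_sum (a := Real.sin θ * Real.cos θ)]
      exact Finset.sum_congr rfl fun a _ => Finset.sum_congr rfl fun b _ => by ring
    simp only [Pi.zero_apply]
    rw [e]
    exact mul_nonneg hsc key
  have hp : 0 ≤ Real.pi / 2 := by positivity
  rw [← h0, ← h1]
  exact hmono (Set.left_mem_Icc.2 hp) (Set.right_mem_Icc.2 hp) hp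

/-- Gordon's comparison for the thresholded min-max. -/
theorem integral_max_iInf_iSup_le (s : ℝ) (x y : ι × κ → Fin N → ℝ)
    (hne : ∀ a b : ι × κ, a.1 ≠ b.1 →
      ∑ k, (x a k - x b k) ^ 2 ≤ ∑ k, (y a k - y b k) ^ 2)
    (heq : ∀ a b : ι × κ, a.1 = b.1 →
      ∑ k, (y a k - y b k) ^ 2 ≤ ∑ k, (x a k - x b k) ^ 2)
    (hnorm : ∀ a, ∑ k, y a k ^ 2 ≤ ∑ k, x a k ^ 2) :
    ∫ g, max s (⨅ i, ⨆ j, lin y g (i, j)) ∂(gaussPi N) ≤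
      ∫ g, max s (⨅ i, ⨆ j, lin x g (i, j)) ∂(gaussPi N) := by
  set K : ℝ := Real.log (Fintype.card ι) + Real.log (Fintype.card κ + 1) with hK
  have hscale : ∀ (β : ℝ), 0 < β → ∀ (z : ι × κ → Fin N → ℝ),
      |∫ g, smooth (Real.exp (β * s)) (lin (β • z) g) ∂(gaussPi N) -
        β * ∫ g, max s (⨅ i, ⨆ j, lin z g (i, j)) ∂(gaussPi N)| ≤ K := by
    intro β hβ z
    have hmax : ∀ g, β * max s (⨅ i, ⨆ j, lin z g (i, j)) =
        max (β * s) (⨅ i, ⨆ j, lin (β • z) g (i, j)) := by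
      intro g
      rw [mul_max_of_nonneg _ _ hβ.le, Real.mul_iInf_of_nonneg hβ.le]
      simp only [Real.mul_iSup_of_nonneg hβ.le]
      simp only [lin, Pi.smul_apply, smul_eq_mul, Finset.mul_sum, mul_assoc]
    rw [← integral_const_mul]
    simp only [hmax]
    rw [← integral_sub (integrable_smooth_lin (Real.exp_pos _) _)
      (integrable_max_iInf_iSup_lin _ _)]
    have := norm_integral_le_of_norm_le_const (μ := gaussPi N) (C := K)
      (f := fun g => smooth (Real.exp (β * s)) (lin (β • z) g) -
        max (β * s) (⨅ i, ⨆ j, lin (β • z) g (i, j)))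
      (Filter.Eventually.of_forall fun g => abs_smooth_sub_le (β * s) (lin (β • z) g))
    simpa using this
  have hβ : ∀ β : ℝ, 0 < β →
      β * (∫ g, max s (⨅ i, ⨆ j, lin y g (i, j)) ∂(gaussPi N) -
        ∫ g, max s (⨅ i, ⨆ j, lin x g (i, j)) ∂(gaussPi N)) ≤ 2 * K := by
    intro β hβ
    have hx := abs_le.1 (hscale β hβ x)
    have hy := abs_le.1 (hscale β hβ y)
    have h := integral_smooth_le (Real.exp_pos (β * s)) (β • x) (β • y)
      (fun a b hab => by
        simpa [← mul_sub, mul_pow, ← Finset.mul_sum] using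
          mul_le_mul_of_nonneg_left (hne a b hab) (sq_nonneg β))
      (fun a b hab => by
        simpa [← mul_sub, mul_pow, ← Finset.mul_sum] using
          mul_le_mul_of_nonneg_left (heq a b hab) (sq_nonneg β))
      (fun a => by
        simpa [mul_pow, ← Finset.mul_sum] using
          mul_le_mul_of_nonneg_left (hnorm a) (sq_nonneg β))
    linarith [hx.2, hy.1]
  by_contra hlt
  rw [not_le, ← sub_pos] at hlt
  obtain ⟨n, hn⟩ := exists_nat_gt (2 * K / _ : ℝ)
  have h := hβ (n + 1) (by positivity)
  rw [div_lt_iff₀ hlt] at hn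
  linarith

end Comparison

end SmoothMinMax

/-- The truncations of an up-closed set of positive reals have the measure of a hinge function. -/
lemma volume_inter_Iio_of_isUpperSet {U : Set ℝ} (hU : ∀ s ∈ U, ∀ t, s ≤ t → t ∈ U)
    (hne : U.Nonempty) (hbdd : BddBelow U) (a : ℝ) :
    volume (U ∩ Set.Iio a) = ENNReal.ofReal (a - sInf U) := by
  refine le_antisymm ?_ ?_
  · rw [← Real.volume_Ico]
    exact measure_mono fun s hs => ⟨csInf_le hbdd hs.1, hs.2⟩
  · rw [← Real.volume_Ioo]
    refine measure_mono fun s hs => ⟨?_, hs.2⟩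
    obtain ⟨t, ht, hts⟩ := exists_lt_of_csInf_lt hne hs.1
    exact hU t ht s hts.le

/-- A convex function which is constant on the negative axis, as the area under its slope. -/
lemma ofReal_sub_eq_lintegral_volume {φ : ℝ → ℝ} (hconv : ConvexOn ℝ Set.univ φ)
    (hneg : ∀ x ≤ 0, φ x = φ 0) {D : ℝ → ℝ} (hD : Monotone D)
    (hD0 : ∀ s, 0 ≤ D s) (hderiv : ∀ s, HasDerivWithinAt φ (D s) (Set.Ioi s) s) (x : ℝ) :
    ENNReal.ofReal (φ x - φ 0) =
      ∫⁻ r, volume ({s | 0 < s ∧ 0 < r ∧ r < D s} ∩ Set.Iio x) := by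
  rcases le_or_gt x 0 with hx | hx
  · have h : ∀ r, {s | 0 < s ∧ 0 < r ∧ r < D s} ∩ Set.Iio x = ∅ := fun r =>
      Set.eq_empty_of_forall_notMem fun s hs => absurd hs.2 (not_lt.2 (hx.trans hs.1.1.le))
    simp [hneg x hx, h]
  have hcont : Continuous φ := by
    simpa [continuousOn_univ] using hconv.continuousOn isOpen_univ
  have hInt : IntervalIntegrable D volume 0 x := hD.intervalIntegrable
  have hFTC := intervalIntegral.integral_eq_sub_of_hasDeriv_right hcont.continuousOn
    (fun s _ => hderiv s) hInt
  have hI : IntegrableOn D (Set.Ioo 0 x) :=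
    ((intervalIntegrable_iff_integrableOn_Ioc_of_le hx.le).1 hInt).mono_set Set.Ioo_subset_Ioc_self
  have hreg := volume_regionBetween_eq_integral (μ := volume) (f := fun _ => (0 : ℝ)) (g := D)
    (s := Set.Ioo 0 x) (integrableOn_zero) hI measurableSet_Ioo (fun s _ => hD0 s)
  rw [← hFTC, intervalIntegral.integral_of_le hx.le, integral_Ioc_eq_integral_Ioo]
  simp only [Pi.sub_apply, sub_zero] at hreg
  rw [← hreg, Measure.prod_apply_symm
    (measurableSet_regionBetween measurable_const hD.measurable measurableSet_Ioo)]
  refine lintegral_congr fun r => congrArg _ ?_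
  ext s
  simp only [regionBetween, Set.mem_preimage, Set.mem_ofPred_eq, Set.mem_Ioo, Set.mem_inter_iff,
    Set.mem_Iio]
  tauto

/-- Domination of all hinge expectations implies domination for increasing convex functions. -/
theorem integral_comp_le_of_hinge {Ω : Type*} [MeasurableSpace Ω] {μ : Measure Ω}
    [IsProbabilityMeasure μ] {φ : ℝ → ℝ} (hconv : ConvexOn ℝ Set.univ φ) (hmono : Monotone φ)
    (hneg : ∀ x ≤ 0, φ x = φ 0) {A B : Ω → ℝ} (hA : Measurable A) (hB : Measurable B)
    (hAB : ∀ s, ∫⁻ ω, ENNReal.ofReal (A ω - s) ∂μ ≤ ∫⁻ ω, ENNReal.ofReal (B ω - s) ∂μ)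
    (hiA : Integrable (fun ω => φ (A ω)) μ) (hiB : Integrable (fun ω => φ (B ω)) μ) :
    ∫ ω, φ (A ω) ∂μ ≤ ∫ ω, φ (B ω) ∂μ := by
  set D : ℝ → ℝ := fun s => derivWithin φ (Set.Ioi s) s with hDdef
  have hderiv : ∀ s, HasDerivWithinAt φ (D s) (Set.Ioi s) s := fun s =>
    hconv.hasDerivWithinAt_rightDeriv_of_mem_interior (by simp)
  have hD : Monotone D := by
    have := hconv.monotoneOn_rightDeriv
    rwa [interior_univ, monotoneOn_univ] at this
  have hD0 : ∀ s, 0 ≤ D s := fun s => (hmono.monotoneOn _).derivWithin_nonneg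
  have hrep := ofReal_sub_eq_lintegral_volume hconv hneg hD hD0 hderiv
  have hlow : ∀ x, φ 0 ≤ φ x := fun x => by
    rcases le_total x 0 with h | h
    · exact (hneg x h).ge
    · exact hmono h
  have hswap : ∀ {Z : Ω → ℝ}, Measurable Z → ∫⁻ ω, ENNReal.ofReal (φ (Z ω) - φ 0) ∂μ =
      ∫⁻ r, ∫⁻ ω, volume ({s | 0 < s ∧ 0 < r ∧ r < D s} ∩ Set.Iio (Z ω)) ∂μ := by
    intro Z hZ
    simp only [hrep]
    refine lintegral_lintegral_swap (Measurable.aemeasurable ?_)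
    have hT : MeasurableSet {p : (Ω × ℝ) × ℝ |
        (0 < p.2 ∧ 0 < p.1.2 ∧ p.1.2 < D p.2) ∧ p.2 < Z p.1.1} := by
      have hDm := hD.measurable
      have hpos : MeasurableSet {p : (Ω × ℝ) × ℝ | 0 < p.2} :=
        measurableSet_lt (by fun_prop) (by fun_prop)
      have hpos' : MeasurableSet {p : (Ω × ℝ) × ℝ | 0 < p.1.2} :=
        measurableSet_lt (by fun_prop) (by fun_prop)
      have hlt : MeasurableSet {p : (Ω × ℝ) × ℝ | p.1.2 < D p.2} :=
        measurableSet_lt (by fun_prop) (by fun_prop)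
      have hlt' : MeasurableSet {p : (Ω × ℝ) × ℝ | p.2 < Z p.1.1} :=
        measurableSet_lt (by fun_prop) (by fun_prop)
      exact (hpos.inter (hpos'.inter hlt)).inter hlt'
    exact measurable_measure_prodMk_left (ν := (volume : Measure ℝ)) hT
  have hle : ∫⁻ ω, ENNReal.ofReal (φ (A ω) - φ 0) ∂μ ≤
      ∫⁻ ω, ENNReal.ofReal (φ (B ω) - φ 0) ∂μ := by
    rw [hswap hA, hswap hB]
    refine lintegral_mono fun r => ?_
    rcases Set.eq_empty_or_nonempty {s | 0 < s ∧ 0 < r ∧ r < D s} with h | h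
    · simp [h]
    · have hup : ∀ s ∈ {s | 0 < s ∧ 0 < r ∧ r < D s}, ∀ t, s ≤ t →
          t ∈ {s | 0 < s ∧ 0 < r ∧ r < D s} := fun s hs t hst =>
        ⟨hs.1.trans_le hst, hs.2.1, hs.2.2.trans_le (hD hst)⟩
      have hbdd : BddBelow {s | 0 < s ∧ 0 < r ∧ r < D s} := ⟨0, fun s hs => hs.1.le⟩
      simp only [volume_inter_Iio_of_isUpperSet hup h hbdd]
      exact hAB _
  have hiA' : Integrable (fun ω => φ (A ω) - φ 0) μ := hiA.sub (integrable_const _)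
  have hiB' : Integrable (fun ω => φ (B ω) - φ 0) μ := hiB.sub (integrable_const _)
  have hnn : ∀ Z : Ω → ℝ, 0 ≤ᵐ[μ] fun ω => φ (Z ω) - φ 0 := fun Z =>
    Filter.Eventually.of_forall fun ω => sub_nonneg.2 (hlow (Z ω))
  have h := (ofReal_integral_eq_lintegral_ofReal hiA' (hnn A)).le.trans
    (hle.trans (ofReal_integral_eq_lintegral_ofReal hiB' (hnn B)).ge)
  rw [ENNReal.ofReal_le_ofReal_iff (integral_nonneg_of_ae (hnn B))] at h
  rw [integral_sub hiA (integrable_const _), integral_sub hiB (integrable_const _)] at h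
  linarith

lemma convexOn_of_eq_ite {f fplus : ℝ → ℝ} (hf_mono : MonotoneOn f (Set.Ici 0))
    (hf_conv : ConvexOn ℝ (Set.Ici 0) f)
    (hfplus : ∀ x : ℝ, fplus x = if 0 ≤ x then f x else f 0) :
    ConvexOn ℝ Set.univ fplus ∧ Monotone fplus := by
  have h : fplus = f ∘ fun x => max x 0 := by
    ext x
    rw [hfplus]
    split_ifs with hx
    · simp [hx]
    · simp [(not_le.1 hx).le]
  have himg : (fun x : ℝ => max x 0) '' Set.univ = Set.Ici 0 := by
    ext t
    constructor
    · rintro ⟨x, -, rfl⟩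
      exact le_max_right x 0
    · intro ht
      exact ⟨t, trivial, max_eq_left ht⟩
  rw [h]
  refine ⟨ConvexOn.comp (by rwa [himg]) ?_ (by rwa [himg]), fun x y hxy => ?_⟩
  · exact (convexOn_id convex_univ).sup (convexOn_const 0 convex_univ)
  · exact hf_mono (le_max_right x 0) (le_max_right y 0) (max_le_max_right 0 hxy)

lemma measurable_iInf_iSup_lin {ι κ : Type*} [Finite ι] [Finite κ] {M : ℕ}
    (z : ι × κ → Fin M → ℝ) :
    Measurable fun g => ⨅ i, ⨆ j, SmoothMinMax.lin z g (i, j) :=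
  Measurable.iInf fun i => Measurable.iSup fun j =>
    (continuous_pi_iff.1 (SmoothMinMax.continuous_lin z) (i, j)).measurable

lemma lintegral_ofReal_iInf_iSup_lin_sub {ι κ : Type*} [Fintype ι] [Fintype κ] [Nonempty ι]
    [Nonempty κ] {M : ℕ} (z : ι × κ → Fin M → ℝ) (s : ℝ) :
    ∫⁻ g, ENNReal.ofReal ((⨅ i, ⨆ j, SmoothMinMax.lin z g (i, j)) - s) ∂gaussPi M =
      ENNReal.ofReal
        (∫ g, max s (⨅ i, ⨆ j, SmoothMinMax.lin z g (i, j)) ∂gaussPi M - s) := by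
  have hi := SmoothMinMax.integrable_max_iInf_iSup_lin s z
  have hsub : Integrable (fun g => max s (⨅ i, ⨆ j, SmoothMinMax.lin z g (i, j)) - s)
      (gaussPi M) := hi.sub (integrable_const s)
  have hInt : ∫ g, (max s (⨅ i, ⨆ j, SmoothMinMax.lin z g (i, j)) - s) ∂gaussPi M =
      ∫ g, max s (⨅ i, ⨆ j, SmoothMinMax.lin z g (i, j)) ∂gaussPi M - s := by
    rw [integral_sub hi (integrable_const s)]
    simp
  rw [← hInt, ofReal_integral_eq_lintegral_ofReal hsub
    (Filter.Eventually.of_forall fun g => sub_nonneg.2 (le_max_left _ _))]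
  refine lintegral_congr fun g => ?_
  rw [max_comm, ← max_sub_sub_right, sub_self, ENNReal.ofReal_max]
  simp

lemma iInf_iSup_comp_inner_equiv_symm {ι κ : Type*} [Finite ι] [Finite κ] [Nonempty ι]
    [Nonempty κ] {N : ℕ} {φ : ℝ → ℝ} (hφ : Monotone φ) (z : ι → κ → Euc N) (g : Fin N → ℝ) :
    ⨅ i, ⨆ j, φ ⟪z i j, (EuclideanSpace.equiv (Fin N) ℝ).symm g⟫_ℝ =
      φ (⨅ i, ⨆ j, SmoothMinMax.lin (fun a : ι × κ => fun k => z a.1 a.2 k) g (i, j)) := by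
  rw [Finite.map_iInf_of_monotone _ hφ]
  simp only [Finite.map_iSup_of_monotone _ hφ]
  simp [SmoothMinMax.lin, PiLp.inner_apply, mul_comm]

lemma measurableEmbedding_equiv_symm (N : ℕ) :
    MeasurableEmbedding ⇑(EuclideanSpace.equiv (Fin N) ℝ).symm :=
  (EuclideanSpace.equiv (Fin N) ℝ).symm.toHomeomorph.measurableEmbedding

lemma sum_sq_le_sum_sq_of_norm_le {N : ℕ} {u v : Euc N} (h : ‖u‖ ≤ ‖v‖) :
    ∑ k, u k ^ 2 ≤ ∑ k, v k ^ 2 := by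
  rw [← EuclideanSpace.real_norm_sq_eq, ← EuclideanSpace.real_norm_sq_eq]
  exact pow_le_pow_left₀ (norm_nonneg u) h 2

/-- a variant of Gordon's comparison theorem, geometric form. Under the stated
distance hypotheses on the vectors `x₀, x_{ij}, y₀, y_{ij}` and for monotone convex
`f : [0,∞) → ℝ` with `f₊` its extension by `f(0)`,
`E[min_i max_j f₊(⟨x_{ij} − x₀, g⟩)] ≥ E[min_i max_j f₊(⟨y_{ij} − y₀, g⟩)]`. -/
theorem statement19 {m n N : ℕ} [NeZero m] [NeZero n]
    (f : ℝ → ℝ) (hf_mono : MonotoneOn f (Set.Ici 0)) (hf_conv : ConvexOn ℝ (Set.Ici 0) f)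
    (fplus : ℝ → ℝ) (hfplus : ∀ x : ℝ, fplus x = if 0 ≤ x then f x else f 0)
    (x₀ y₀ : Euc N) (x y : Fin m → Fin n → Euc N)
    (h1 : ∀ i k : Fin m, i ≠ k → ∀ j l : Fin n, ‖x i j - x k l‖ ≤ ‖y i j - y k l‖)
    (h2 : ∀ (i : Fin m) (j l : Fin n), ‖y i j - y i l‖ ≤ ‖x i j - x i l‖)
    (h3 : ∀ (i : Fin m) (j : Fin n), ‖y i j - y₀‖ ≤ ‖x i j - x₀‖)
    (hintx : Integrable (fun g => ⨅ i : Fin m, ⨆ j : Fin n, fplus ⟪x i j - x₀, g⟫_ℝ)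
      (stdGaussianE N))
    (hinty : Integrable (fun g => ⨅ i : Fin m, ⨆ j : Fin n, fplus ⟪y i j - y₀, g⟫_ℝ)
      (stdGaussianE N)) :
    ∫ g, (⨅ i : Fin m, ⨆ j : Fin n, fplus ⟪y i j - y₀, g⟫_ℝ) ∂(stdGaussianE N)
      ≤ ∫ g, (⨅ i : Fin m, ⨆ j : Fin n, fplus ⟪x i j - x₀, g⟫_ℝ) ∂(stdGaussianE N) := by
  obtain ⟨hconv, hmono⟩ := convexOn_of_eq_ite hf_mono hf_conv hfplus
  have hneg : ∀ t ≤ 0, fplus t = fplus 0 := by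
    intro t ht
    rcases ht.eq_or_lt with rfl | ht
    · rfl
    · simp [hfplus, not_le.2 ht]
  have he := measurableEmbedding_equiv_symm N
  have hpull := fun z : Fin m → Fin n → Euc N => iInf_iSup_comp_inner_equiv_symm hmono z
  unfold stdGaussianE at *
  rw [he.integrable_map_iff] at hintx hinty
  rw [he.integral_map, he.integral_map]
  simp only [Function.comp_def, hpull fun i j => x i j - x₀, hpull fun i j => y i j - y₀]
    at hintx hinty ⊢
  refine integral_comp_le_of_hinge hconv hmono hneg (measurable_iInf_iSup_lin _)
    (measurable_iInf_iSup_lin _) (fun s => ?_) hinty hintx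
  rw [lintegral_ofReal_iInf_iSup_lin_sub, lintegral_ofReal_iInf_iSup_lin_sub]
  refine ENNReal.ofReal_le_ofReal (sub_le_sub_right
    (SmoothMinMax.integral_max_iInf_iSup_le s _ _ (fun a b hab => ?_) (fun a b hab => ?_)
      fun a => sum_sq_le_sum_sq_of_norm_le (h3 a.1 a.2)) s)
  · simpa using sum_sq_le_sum_sq_of_norm_le (h1 a.1 b.1 hab a.2 b.2)
  · obtain ⟨i, j⟩ := a
    obtain ⟨k, l⟩ := b
    obtain rfl : i = k := hab
    simpa using sum_sq_le_sum_sq_of_norm_le (h2 i j l)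

end
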